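/- Let α ∈ (0,2) and γ > α/2. Then the following three integrals are finite: ∫_{−1}^1 k_ε(y)² |y|^{−1−α} dy < +∞, ∫_{−1}^1 (k_ε(y)/y)² |y|^{−1−α} dy < +∞, and ∫_{−1}^1 k_ε'(y)² |y|^{−1−α} dy < +∞. -/

import Mathlib

open Set

/-- The constant `c = (1+γ)ε / ((1+γ) − ε(1+2γ))`. -/
noncomputable def kepsConst (γ ε : ℝ) : ℝ :=
  (1 + γ) * ε / ((1 + γ) - ε * (1 + 2 * γ))

/-- The even perturbation function `k_ε` on `[−1,1]`, defined on `[0,1]` by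
`y^{1+γ}` on `[0,ε]`, by `ε^{1+γ} + (1+γ)ε^γ(y−ε) − (1+c)(y−ε)^{1+γ}` on `[ε,2ε]`,
and by `(1+γ−c)ε^{1+γ} − c(1+γ)ε^γ(y−2ε)` on `[2ε,1]`. -/
noncomputable def keps (γ ε : ℝ) (y : ℝ) : ℝ :=
  if |y| ≤ ε then |y| ^ (1 + γ)
  else if |y| ≤ 2 * ε then
    ε ^ (1 + γ) + (1 + γ) * ε ^ γ * (|y| - ε) - (1 + kepsConst γ ε) * (|y| - ε) ^ (1 + γ)
  else (1 + γ - kepsConst γ ε) * ε ^ (1 + γ) - kepsConst γ ε * (1 + γ) * ε ^ γ * (|y| - 2 * ε)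


open MeasureTheory in
lemma aux_abs_rpow (s : ℝ) (hs : -1 < s) :
    IntegrableOn (fun y : ℝ => |y| ^ s) (Icc (-1 : ℝ) 1) := by
  have h1 : IntervalIntegrable (fun y : ℝ => |y| ^ s) volume 0 1 := by
    refine (intervalIntegral.intervalIntegrable_rpow' hs (a := 0) (b := 1)).congr ?_
    intro y hy
    rw [uIoc_of_le zero_le_one] at hy
    simp only [abs_of_pos hy.1]
  have h2 : IntervalIntegrable (fun y : ℝ => |y| ^ s) volume (-1) 0 := by
    have := (intervalIntegrable_iff_integrableOn_Icc_of_le zero_le_one).1 h1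
    have h3 := this.comp_neg
    rw [intervalIntegrable_iff_integrableOn_Icc_of_le (by norm_num)]
    simpa using h3
  exact (intervalIntegrable_iff_integrableOn_Icc_of_le (by norm_num)).1 (h2.trans h1)

open MeasureTheory in
lemma aux_main (α γ C : ℝ) (hγ : α / 2 < γ) (f : ℝ → ℝ)
    (hf : AEStronglyMeasurable f (volume.restrict (Icc (-1 : ℝ) 1)))
    (hb : ∀ᵐ y ∂(volume.restrict (Icc (-1 : ℝ) 1)), |f y| ≤ C * |y| ^ γ) :
    IntegrableOn (fun y : ℝ => (f y) ^ 2 * |y| ^ (-(1 + α))) (Icc (-1 : ℝ) 1) := by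
  have hi := (aux_abs_rpow (2 * γ - (1 + α)) (by linarith)).const_mul (C ^ 2)
  refine Integrable.mono' hi ?_ ?_
  · refine (hf.pow 2).mul ?_
    exact (Measurable.aestronglyMeasurable (by fun_prop))
  · have h0 : ∀ᵐ y ∂(volume.restrict (Icc (-1 : ℝ) 1)), y ≠ 0 :=
      ae_restrict_of_ae (Measure.ae_ne volume 0)
    filter_upwards [hb, h0] with y hy hy0
    have hp : 0 < |y| := abs_pos.2 hy0
    have e : |y| ^ (2 * γ - (1 + α)) = (|y| ^ γ) ^ 2 * |y| ^ (-(1 + α)) := by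
      rw [sub_eq_add_neg, Real.rpow_add hp, two_mul, Real.rpow_add hp, sq]
    rw [e, Real.norm_eq_abs, abs_mul, abs_pow, abs_of_nonneg (Real.rpow_nonneg hp.le (-(1 + α))),
      ← mul_assoc, ← mul_pow]
    gcongr

lemma keps_bound (γ ε : ℝ) (hγ : 0 < γ) (hε : 0 < ε) :
    ∃ C : ℝ, ∀ y, |keps γ ε y| ≤ C * |y| ^ (1 + γ) := by
  set c := kepsConst γ ε with hc
  refine ⟨1 + (1 + γ) + |1 + c| + |1 + γ - c| + |c| * (1 + γ), fun y => ?_⟩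
  have hx := abs_nonneg y
  unfold keps
  rw [← hc]
  generalize |y| = x at *
  have hX : 0 ≤ x ^ (1 + γ) := Real.rpow_nonneg hx _
  have a1 := abs_nonneg (1 + c)
  have a2 := abs_nonneg (1 + γ - c)
  have a3 : 0 ≤ |c| * (1 + γ) := by positivity
  split_ifs with h1 h2
  · rw [abs_of_nonneg hX]
    nlinarith
  · push Not at h1
    have b1 : ε ^ (1 + γ) ≤ x ^ (1 + γ) := Real.rpow_le_rpow hε.le h1.le (by linarith)
    have b2 : ε ^ γ * (x - ε) ≤ x ^ (1 + γ) := by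
      rw [add_comm, Real.rpow_add_one (by linarith)]
      have := Real.rpow_le_rpow hε.le h1.le hγ.le
      gcongr
      linarith
    have b3 : (x - ε) ^ (1 + γ) ≤ x ^ (1 + γ) :=
      Real.rpow_le_rpow (by linarith) (by linarith) (by linarith)
    have p1 : 0 ≤ ε ^ (1 + γ) := by positivity
    have p2 : 0 ≤ ε ^ γ * (x - ε) := mul_nonneg (by positivity) (by linarith)
    have p3 : 0 ≤ (x - ε) ^ (1 + γ) := Real.rpow_nonneg (by linarith) _
    calc _ ≤ |ε ^ (1 + γ)| + |(1 + γ) * ε ^ γ * (x - ε)| + |(1 + c) * (x - ε) ^ (1 + γ)| :=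
          (abs_sub _ _).trans (by gcongr; exact abs_add_le _ _)
      _ = ε ^ (1 + γ) + (1 + γ) * (ε ^ γ * (x - ε)) + |1 + c| * (x - ε) ^ (1 + γ) := by
          rw [mul_assoc, abs_mul, abs_mul (1 + c), abs_of_nonneg p1, abs_of_nonneg p2,
            abs_of_nonneg p3, abs_of_nonneg (by linarith : 0 ≤ 1 + γ)]
      _ ≤ x ^ (1 + γ) + (1 + γ) * x ^ (1 + γ) + |1 + c| * x ^ (1 + γ) := by gcongr
      _ ≤ _ := by nlinarith [mul_nonneg a2 hX, mul_nonneg a3 hX]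
  · push Not at h1 h2
    have b1 : ε ^ (1 + γ) ≤ x ^ (1 + γ) := Real.rpow_le_rpow hε.le h1.le (by linarith)
    have b2 : ε ^ γ * (x - 2 * ε) ≤ x ^ (1 + γ) := by
      rw [add_comm, Real.rpow_add_one (by linarith)]
      have := Real.rpow_le_rpow hε.le h1.le hγ.le
      gcongr
      linarith
    have p1 : 0 ≤ ε ^ (1 + γ) := by positivity
    have p2 : 0 ≤ ε ^ γ * (x - 2 * ε) := mul_nonneg (by positivity) (by linarith)
    calc _ ≤ |(1 + γ - c) * ε ^ (1 + γ)| + |c * (1 + γ) * ε ^ γ * (x - 2 * ε)| := abs_sub _ _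
      _ = |1 + γ - c| * ε ^ (1 + γ) + |c| * (1 + γ) * (ε ^ γ * (x - 2 * ε)) := by
          rw [mul_assoc (c * (1 + γ)), abs_mul, abs_mul (c * (1 + γ)), abs_mul c,
            abs_of_nonneg p1, abs_of_nonneg p2, abs_of_nonneg (by linarith : 0 ≤ 1 + γ)]
      _ ≤ |1 + γ - c| * x ^ (1 + γ) + |c| * (1 + γ) * x ^ (1 + γ) := by gcongr
      _ ≤ _ := by nlinarith [mul_nonneg a1 hX, mul_nonneg hγ.le hX]

lemma keps_deriv_bound_pos (γ ε : ℝ) (hγ : 0 < γ) (hε : 0 < ε) :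
    ∃ C : ℝ, ∀ x, 0 < x → x ≠ ε → x ≠ 2 * ε → |deriv (keps γ ε) x| ≤ C * x ^ γ := by
  set c := kepsConst γ ε with hc
  refine ⟨(1 + γ) * (1 + |1 + c| + |c|), fun x hx n1 n2 => ?_⟩
  have hX : 0 ≤ x ^ γ := Real.rpow_nonneg hx.le _
  have a1 := mul_nonneg (abs_nonneg (1 + c)) hX
  have a2 := mul_nonneg (abs_nonneg c) hX
  have g : 0 ≤ 1 + γ := by linarith
  rcases lt_or_gt_of_ne n1 with h1 | h1
  · have he : keps γ ε =ᶠ[nhds x] fun y => y ^ (1 + γ) := by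
      filter_upwards [Ioo_mem_nhds hx h1] with y hy
      have := abs_of_pos hy.1
      simp only [keps, this, if_pos hy.2.le]
    rw [he.deriv_eq, (Real.hasDerivAt_rpow_const (Or.inl hx.ne')).deriv, add_sub_cancel_left,
      abs_of_nonneg (mul_nonneg g hX), mul_assoc]
    gcongr
    nlinarith
  · have b1 : ε ^ γ ≤ x ^ γ := Real.rpow_le_rpow hε.le h1.le hγ.le
    have p1 : 0 ≤ ε ^ γ := by positivity
    rcases lt_or_gt_of_ne n2 with h2 | h2
    · have he : keps γ ε =ᶠ[nhds x] fun y => ε ^ (1 + γ) + (1 + γ) * ε ^ γ * (y - ε)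
          - (1 + c) * (y - ε) ^ (1 + γ) := by
        filter_upwards [Ioo_mem_nhds h1 h2] with y hy
        have := abs_of_pos (hε.trans hy.1)
        simp only [keps, this, if_neg (not_le.2 hy.1), if_pos hy.2.le, hc]
      have hd : HasDerivAt (fun y => ε ^ (1 + γ) + (1 + γ) * ε ^ γ * (y - ε)
          - (1 + c) * (y - ε) ^ (1 + γ))
          ((1 + γ) * ε ^ γ * 1 - (1 + c) * (1 * (1 + γ) * (x - ε) ^ (1 + γ - 1))) x := by
        have h0 : HasDerivAt (fun y : ℝ => y - ε) 1 x := (hasDerivAt_id x).sub_const ε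
        exact ((h0.const_mul _).const_add _).sub
          ((h0.rpow_const (Or.inl (by linarith : 0 < x - ε).ne')).const_mul _)
      have b2 : (x - ε) ^ γ ≤ x ^ γ := Real.rpow_le_rpow (by linarith) (by linarith) hγ.le
      have p2 : 0 ≤ (x - ε) ^ γ := Real.rpow_nonneg (by linarith) _
      rw [he.deriv_eq, hd.deriv, add_sub_cancel_left]
      calc _ = |(1 + γ) * (ε ^ γ - (1 + c) * (x - ε) ^ γ)| := by ring_nf
        _ = (1 + γ) * |ε ^ γ - (1 + c) * (x - ε) ^ γ| := by rw [abs_mul, abs_of_nonneg g]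
        _ ≤ (1 + γ) * (|ε ^ γ| + |(1 + c) * (x - ε) ^ γ|) := by gcongr; exact abs_sub _ _
        _ = (1 + γ) * (ε ^ γ + |1 + c| * (x - ε) ^ γ) := by
          rw [abs_mul, abs_of_nonneg p1, abs_of_nonneg p2]
        _ ≤ (1 + γ) * (x ^ γ + |1 + c| * x ^ γ) := by gcongr
        _ ≤ (1 + γ) * ((1 + |1 + c| + |c|) * x ^ γ) := by gcongr; nlinarith
        _ = _ := by ring
    · have he : keps γ ε =ᶠ[nhds x] fun y => (1 + γ - c) * ε ^ (1 + γ)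
          - c * (1 + γ) * ε ^ γ * (y - 2 * ε) := by
        filter_upwards [Ioi_mem_nhds h2] with y hy
        have hy : 2 * ε < y := hy
        have := abs_of_pos (by linarith : 0 < y)
        simp only [keps, this, if_neg (not_le.2 hy), if_neg (not_le.2 (by linarith : ε < y)), hc]
      have hd : HasDerivAt (fun y => (1 + γ - c) * ε ^ (1 + γ)
          - c * (1 + γ) * ε ^ γ * (y - 2 * ε)) (-(c * (1 + γ) * ε ^ γ * 1)) x := by
        have h0 : HasDerivAt (fun y : ℝ => y - 2 * ε) 1 x := (hasDerivAt_id x).sub_const _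
        exact (h0.const_mul _).const_sub _
      rw [he.deriv_eq, hd.deriv, abs_neg, mul_one, abs_mul, abs_mul, abs_of_nonneg p1,
        abs_of_nonneg g]
      calc _ = (1 + γ) * (|c| * ε ^ γ) := by ring
        _ ≤ (1 + γ) * (|c| * x ^ γ) := by gcongr
        _ ≤ (1 + γ) * ((1 + |1 + c| + |c|) * x ^ γ) := by gcongr; linarith [abs_nonneg (1 + c)]
        _ = _ := by ring

lemma keps_deriv_bound (γ ε : ℝ) (hγ : 0 < γ) (hε : 0 < ε) :
    ∃ C : ℝ, ∀ y, y ≠ 0 → |y| ≠ ε → |y| ≠ 2 * ε → |deriv (keps γ ε) y| ≤ C * |y| ^ γ := by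
  obtain ⟨C, hC⟩ := keps_deriv_bound_pos γ ε hγ hε
  refine ⟨C, fun y h0 h1 h2 => ?_⟩
  have h := hC |y| (abs_pos.2 h0) h1 h2
  rcases abs_choice y with e | e
  · rwa [e] at h ⊢
  · have hev : (fun x => keps γ ε (-x)) = keps γ ε := by
      funext x; simp only [keps, abs_neg]
    have := deriv_comp_neg (keps γ ε) y
    rw [hev] at this
    rw [this, abs_neg]
    rwa [e] at h ⊢

lemma keps_measurable (γ ε : ℝ) : Measurable (keps γ ε) := by
  unfold keps
  refine Measurable.ite (measurableSet_le (by fun_prop) (by fun_prop)) (by fun_prop) ?_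
  exact Measurable.ite (measurableSet_le (by fun_prop) (by fun_prop)) (by fun_prop) (by fun_prop)

open MeasureTheory in
/-- For `α ∈ (0,2)` and `γ > α/2`, the integrals
`∫_{−1}^1 k_ε(y)² |y|^{−1−α} dy`, `∫_{−1}^1 (k_ε(y)/y)² |y|^{−1−α} dy` and
`∫_{−1}^1 k_ε'(y)² |y|^{−1−α} dy` are all finite. -/
theorem keps_integrability (α γ ε : ℝ) (hα : α ∈ Ioo (0 : ℝ) 2) (hγ : α / 2 < γ)
    (hε : ε ∈ Ioo (0 : ℝ) (1 / 2)) :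
    IntegrableOn (fun y : ℝ => (keps γ ε y) ^ 2 * |y| ^ (-(1 + α))) (Icc (-1 : ℝ) 1) ∧
    IntegrableOn (fun y : ℝ => (keps γ ε y / y) ^ 2 * |y| ^ (-(1 + α))) (Icc (-1 : ℝ) 1) ∧
    IntegrableOn
      (fun y : ℝ => (derivWithin (keps γ ε) (Icc (-1 : ℝ) 1) y) ^ 2 * |y| ^ (-(1 + α)))
      (Icc (-1 : ℝ) 1) := by
  have hg : 0 < γ := by linarith [hα.1]
  obtain ⟨C, hC⟩ := keps_bound γ ε hg hε.1
  obtain ⟨D, hD⟩ := keps_deriv_bound γ ε hg hε.1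
  have hm := keps_measurable γ ε
  have hC0 : 0 ≤ C := by
    have := (abs_nonneg _).trans (hC 1)
    simpa using this
  refine ⟨aux_main α γ C hγ _ hm.aestronglyMeasurable ?_,
    aux_main α γ C hγ _ (hm.div measurable_id).aestronglyMeasurable ?_, ?_⟩
  · filter_upwards [ae_restrict_mem measurableSet_Icc,
      ae_restrict_of_ae (Measure.ae_ne volume (0 : ℝ))] with y hy h0
    refine (hC y).trans ?_
    gcongr C * ?_
    exact Real.rpow_le_rpow_of_exponent_ge (abs_pos.2 h0) (abs_le.2 hy) (by linarith)
  · filter_upwards [ae_restrict_of_ae (Measure.ae_ne volume (0 : ℝ))] with y h0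
    have hp : 0 < |y| := abs_pos.2 h0
    rw [abs_div, div_le_iff₀ hp, mul_assoc, ← Real.rpow_add_one hp.ne', add_comm γ]
    exact hC y
  · have hin : ∀ᵐ y ∂(volume.restrict (Icc (-1 : ℝ) 1)),
        derivWithin (keps γ ε) (Icc (-1 : ℝ) 1) y = deriv (keps γ ε) y := by
      filter_upwards [ae_restrict_mem measurableSet_Icc,
        ae_restrict_of_ae (Measure.ae_ne volume (-1 : ℝ)),
        ae_restrict_of_ae (Measure.ae_ne volume (1 : ℝ))] with y hy h1 h2
      exact derivWithin_of_mem_nhds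
        (Icc_mem_nhds (lt_of_le_of_ne hy.1 h1.symm) (lt_of_le_of_ne hy.2 h2))
    refine aux_main α γ D hγ _ ?_ ?_
    · exact (measurable_deriv (keps γ ε)).aestronglyMeasurable.congr
        (hin.mono fun y hy => hy.symm)
    · filter_upwards [hin, ae_restrict_of_ae (Measure.ae_ne volume (0 : ℝ)),
        ae_restrict_of_ae (Measure.ae_ne volume ε),
        ae_restrict_of_ae (Measure.ae_ne volume (-ε)),
        ae_restrict_of_ae (Measure.ae_ne volume (2 * ε)),
        ae_restrict_of_ae (Measure.ae_ne volume (-(2 * ε)))] with y hy h0 h1 h2 h3 h4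
      rw [hy]
      refine hD y h0 (fun h => ?_) (fun h => ?_)
      · rcases eq_or_eq_neg_of_abs_eq h with h | h
        exacts [h1 h, h2 h]
      · rcases eq_or_eq_neg_of_abs_eq h with h | h
        exacts [h3 h, h4 h]
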